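/- Asymptotic behaviour of the potentials: let d ≥ 11 and p > p_JL. (i) For every integer k ≥ 0: ∂_y^k V = O(1) as y → 0 and ∂_y^k V = c_k·y^{−(2+k)} + O(y^{−(2+α+k)}) as y → ∞ with c_k ≠ 0; ∂_y^k W = O(1) as y → 0 and ∂_y^k W = c'_k·y^{−(1+k)} + O(y^{−(1+g+k)}) as y → ∞ with c'_k ≠ 0, the leading coefficient for k = 0 being −γ (i.e. W = −γ/y + O(y^{−1−g})). (ii) Degeneracy: with Q_λ(y) := λ^{2/(p−1)}Q(λy), for every integer k ≥ 0, ∂_y^k( d/dλ [(Q_λ)^{p−1}]|_{λ=1} ) = O(y^{−(2+α+k)}) as y → ∞. -/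

import Mathlib

noncomputable section

open Real MeasureTheory Filter Asymptotics Set Topology ENNReal

namespace WaveBlowup

/-- The Joseph–Lundgren exponent `p_JL = 1 + 4/(d-4-2√(d-1))`. -/
def pJL (d : ℕ) : ℝ := 1 + 4 / ((d : ℝ) - 4 - 2 * Real.sqrt ((d : ℝ) - 1))

/-- The critical Sobolev exponent `s_c = d/2 - 2/(p-1)`. -/
def sCrit (d : ℕ) (p : ℝ) : ℝ := (d : ℝ) / 2 - 2 / (p - 1)

/-- `c_∞ = [(2/(p-1))(d-2-2/(p-1))]^{1/(p-1)}`. -/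
def cInfty (d : ℕ) (p : ℝ) : ℝ :=
  ((2 / (p - 1)) * ((d : ℝ) - 2 - 2 / (p - 1))) ^ ((1 : ℝ) / (p - 1))

/-- `△ = (d-2)² - 4 p c_∞^{p-1}`. -/
def discr (d : ℕ) (p : ℝ) : ℝ := ((d : ℝ) - 2) ^ 2 - 4 * p * cInfty d p ^ (p - 1)

/-- `γ = (d-2-√△)/2`. -/
def gam (d : ℕ) (p : ℝ) : ℝ := (((d : ℝ) - 2) - Real.sqrt (discr d p)) / 2

/-- `α = γ - 2/(p-1)`, the smaller root of `X² - (d-2-4/(p-1))X + 2(d-2-2/(p-1))`. -/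
def alph (d : ℕ) (p : ℝ) : ℝ := gam d p - 2 / (p - 1)

/-- `α₂`, the other root of the same quadratic (the sum of the roots is `d-2-4/(p-1)`). -/
def alph₂ (d : ℕ) (p : ℝ) : ℝ := ((d : ℝ) - 2 - 4 / (p - 1)) - alph d p

/-- `k₀ = ⌊d/2 - γ⌋`. -/
def kzero (d : ℕ) (p : ℝ) : ℕ := ⌊(d : ℝ) / 2 - gam d p⌋₊

/-- `δ₀ = d/2 - γ - k₀ ∈ (0,1)`. -/
def deltazero (d : ℕ) (p : ℝ) : ℝ := (d : ℝ) / 2 - gam d p - (kzero d p : ℝ)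

/-- `g = min(α, α₂ - α) - ε`. -/
def gconst (d : ℕ) (p ε : ℝ) : ℝ := min (alph d p) (alph₂ d p - alph d p) - ε

/-- `g' = min(g, 2, 1 + δ₀ - ε)`. -/
def gpconst (d : ℕ) (p ε : ℝ) : ℝ := min (gconst d p ε) (min 2 (1 + deltazero d p - ε))

/-- The ground state `Q` in radial representation: the unique smooth positive radially
symmetric solution of `ΔQ + Q^p = 0` on `ℝ^d` with `Q(0) = 1`. -/
structure IsGroundState (d : ℕ) (p : ℝ) (Q : ℝ → ℝ) : Prop where
  smooth : ContDiff ℝ (⊤ : ℕ∞) Q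
  pos : ∀ y : ℝ, 0 ≤ y → 0 < Q y
  ode : ∀ y : ℝ, 0 < y →
    deriv (deriv Q) y + ((d : ℝ) - 1) / y * deriv Q y + Q y ^ p = 0
  at0 : Q 0 = 1
  deriv0 : deriv Q 0 = 0

/-- `Λ⁽¹⁾Q = (2/(p-1) + y ∂_y) Q`. -/
def Lam1 (p : ℝ) (Q : ℝ → ℝ) : ℝ → ℝ := fun y => 2 / (p - 1) * Q y + y * deriv Q y

/-- The potential `W = ∂_y (log Λ⁽¹⁾Q)`. -/
def Wpot (p : ℝ) (Q : ℝ → ℝ) : ℝ → ℝ := fun y => deriv (fun z => Real.log (Lam1 p Q z)) y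

/-- `A u = -∂_y u + W u`. -/
def Aop (p : ℝ) (Q : ℝ → ℝ) (u : ℝ → ℝ) : ℝ → ℝ :=
  fun y => -deriv u y + Wpot p Q y * u y

/-- `A* u = y^{1-d} ∂_y (y^{d-1} u) + W u`. -/
def Astar (d : ℕ) (p : ℝ) (Q : ℝ → ℝ) (u : ℝ → ℝ) : ℝ → ℝ :=
  fun y => deriv (fun z => z ^ (d - 1) * u z) y / y ^ (d - 1) + Wpot p Q y * u y

/-- The linearized operator `L = -Δ - pQ^{p-1}` on radial functions. -/
def Lop (d : ℕ) (p : ℝ) (Q : ℝ → ℝ) (u : ℝ → ℝ) : ℝ → ℝ :=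
  fun y => -(deriv (deriv u) y + ((d : ℝ) - 1) / y * deriv u y) - p * Q y ^ (p - 1) * u y

/-- Adapted derivatives: `u_0 = u`, `u_{k+1} = A u_k` for `k` even, `u_{k+1} = A* u_k`
for `k` odd. -/
def adap (d : ℕ) (p : ℝ) (Q : ℝ → ℝ) : ℕ → (ℝ → ℝ) → (ℝ → ℝ)
  | 0, u => u
  | (k+1), u => if k % 2 = 0 then Aop p Q (adap d p Q k u) else Astar d p Q (adap d p Q k u)

/-- symbol class -/
def Sym : ℕ → ℝ → (ℝ → ℝ) → Prop
  | 0, β, f => f =O[atTop] fun y : ℝ => y ^ (-β)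
  | (n+1), β, f => (∀ y : ℝ, 0 < y → DifferentiableAt ℝ f y) ∧
      (f =O[atTop] fun y : ℝ => y ^ (-β)) ∧ Sym n β (fun y => y * deriv f y)

lemma Sym.isBigO {n : ℕ} {β : ℝ} {f : ℝ → ℝ} (h : Sym n β f) :
    f =O[atTop] fun y : ℝ => y ^ (-β) := by
  cases n with
  | zero => exact h
  | succ n => exact h.2.1

lemma isBigO_congr_pos {f g : ℝ → ℝ} (hfg : ∀ y : ℝ, 0 < y → f y = g y) {u : ℝ → ℝ}
    (h : f =O[atTop] u) : g =O[atTop] u := by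
  refine h.congr' ?_ EventuallyEq.rfl
  filter_upwards [eventually_gt_atTop 0] with y hy using hfg y hy

lemma deriv_congr_pos {f g : ℝ → ℝ} (hfg : ∀ y : ℝ, 0 < y → f y = g y) {y : ℝ} (hy : 0 < y) :
    deriv f y = deriv g y := by
  apply Filter.EventuallyEq.deriv_eq
  filter_upwards [lt_mem_nhds hy] with z hz using hfg z hz

lemma Sym.congr {n : ℕ} {β : ℝ} {f g : ℝ → ℝ} (hfg : ∀ y : ℝ, 0 < y → f y = g y)
    (h : Sym n β f) : Sym n β g := by
  induction n generalizing f g with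
  | zero => exact isBigO_congr_pos hfg h
  | succ n ih =>
    refine ⟨fun y hy => ?_, isBigO_congr_pos hfg h.2.1, ih ?_ h.2.2⟩
    · refine (h.1 y hy).congr_of_eventuallyEq ?_
      filter_upwards [lt_mem_nhds hy] with z hz using (hfg z hz).symm
    · intro y hy
      simp only [deriv_congr_pos hfg hy]

lemma Sym.pred {n : ℕ} {β : ℝ} {f : ℝ → ℝ} (h : Sym (n+1) β f) : Sym n β f := by
  induction n generalizing f with
  | zero => exact h.2.1
  | succ n ih => exact ⟨h.1, h.2.1, ih h.2.2⟩

lemma rpow_isBigO {a b : ℝ} (h : b ≤ a) :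
    (fun y : ℝ => y ^ (-a)) =O[atTop] fun y : ℝ => y ^ (-b) := by
  refine IsBigO.of_bound 1 ?_
  filter_upwards [eventually_ge_atTop 1] with y hy
  have : (0:ℝ) ≤ y := by linarith
  rw [Real.norm_of_nonneg (by positivity), Real.norm_of_nonneg (by positivity), one_mul]
  exact Real.rpow_le_rpow_of_exponent_le hy (by linarith)

lemma Sym.mono {n : ℕ} {a b : ℝ} {f : ℝ → ℝ} (hab : b ≤ a) (h : Sym n a f) : Sym n b f := by
  induction n generalizing f with
  | zero => exact IsBigO.trans h (rpow_isBigO hab)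
  | succ n ih => exact ⟨h.1, h.2.1.trans (rpow_isBigO hab), ih h.2.2⟩

lemma Sym.add {n : ℕ} {a : ℝ} {f g : ℝ → ℝ} (hf : Sym n a f) (hg : Sym n a g) :
    Sym n a (fun y => f y + g y) := by
  induction n generalizing f g with
  | zero => exact IsBigO.add hf hg
  | succ n ih =>
    refine ⟨fun y hy => (hf.1 y hy).add (hg.1 y hy), hf.2.1.add hg.2.1,
      Sym.congr ?_ (ih hf.2.2 hg.2.2)⟩
    intro y hy
    rw [deriv_fun_add (hf.1 y hy) (hg.1 y hy)]; ring

lemma mul_isBigO {a b : ℝ} {f g : ℝ → ℝ} (hf : f =O[atTop] fun y : ℝ => y ^ (-a))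
    (hg : g =O[atTop] fun y : ℝ => y ^ (-b)) :
    (fun y => f y * g y) =O[atTop] fun y : ℝ => y ^ (-(a+b)) := by
  refine (hf.mul hg).congr' EventuallyEq.rfl ?_
  filter_upwards [eventually_gt_atTop 0] with y hy
  rw [← Real.rpow_add hy]; congr 1; ring

lemma Sym.mul {n : ℕ} {a b : ℝ} {f g : ℝ → ℝ} (hf : Sym n a f) (hg : Sym n b g) :
    Sym n (a+b) (fun y => f y * g y) := by
  induction n generalizing f g with
  | zero => exact mul_isBigO hf hg
  | succ n ih =>
    refine ⟨fun y hy => (hf.1 y hy).mul (hg.1 y hy), mul_isBigO hf.2.1 hg.2.1,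
      Sym.congr ?_ ((ih hf.2.2 hg.pred).add (ih hf.pred hg.2.2))⟩
    intro y hy
    rw [deriv_fun_mul (hf.1 y hy) (hg.1 y hy)]; ring

lemma Sym.const_mul {n : ℕ} {a : ℝ} {f : ℝ → ℝ} (c : ℝ) (hf : Sym n a f) :
    Sym n a (fun y => c * f y) := by
  induction n generalizing f with
  | zero => exact IsBigO.const_mul_left hf c
  | succ n ih =>
    refine ⟨fun y hy => (hf.1 y hy).const_mul c, hf.2.1.const_mul_left c,
      Sym.congr ?_ (ih hf.2.2)⟩
    intro y hy
    rw [deriv_const_mul _ (hf.1 y hy)]; ring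

lemma sym_rpow (n : ℕ) (a : ℝ) : Sym n a (fun y => y ^ (-a)) := by
  induction n with
  | zero => exact isBigO_refl _ _
  | succ n ih =>
    refine ⟨fun y hy => (Real.hasDerivAt_rpow_const (Or.inl hy.ne')).differentiableAt,
      isBigO_refl _ _, Sym.congr ?_ (ih.const_mul (-a))⟩
    intro y hy
    rw [(Real.hasDerivAt_rpow_const (Or.inl hy.ne')).deriv, Real.rpow_sub_one hy.ne']
    field_simp

/-- falling product -/
def pc : ℝ → ℕ → ℝ
  | _, 0 => 1
  | j, (k+1) => j * pc (j-1) k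

lemma pc_ne (k : ℕ) : ∀ j : ℝ, j < 0 → pc j k ≠ 0 := by
  induction k with
  | zero => intro j _; simp [pc]
  | succ k ih => intro j hj; simp only [pc]; exact mul_ne_zero hj.ne (ih _ (by linarith))

lemma expansion (k : ℕ) : ∀ (f F : ℝ → ℝ) (c j β : ℝ),
    (∀ y : ℝ, 0 < y → f y = c * y ^ j + F y) → Sym k β F →
    (fun y => iteratedDeriv k f y - c * pc j k * y ^ (j - k)) =O[atTop]
      fun y : ℝ => y ^ (-(β + k)) := by
  induction k with
  | zero =>
    intro f F c j β h hF
    have : Sym 0 β F := hF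
    simp only [iteratedDeriv_zero, pc, Nat.cast_zero, sub_zero, add_zero, mul_one]
    refine isBigO_congr_pos (f := F) ?_ hF
    intro y hy; rw [h y hy]; ring
  | succ k ih =>
    intro f F c j β h hF
    rw [iteratedDeriv_succ']
    have h2 : Sym k (β + 1) (deriv F) := by
      have := (sym_rpow k 1).mul hF.2.2
      rw [add_comm β 1]
      refine this.congr ?_
      intro y hy
      rw [Real.rpow_neg_one]; field_simp
    have := ih (deriv f) (deriv F) (c * j) (j - 1) (β + 1) ?_ h2
    · refine this.congr ?_ ?_
      · intro y
        simp only [pc]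
        push_cast
        rw [show j - 1 - (k:ℝ) = j - (k + 1) by ring]; ring
      · intro y; push_cast; congr 1; ring
    · intro y hy
      rw [deriv_congr_pos h hy]
      rw [(((Real.hasDerivAt_rpow_const (Or.inl hy.ne')).const_mul c).fun_add
        (hF.1 y hy).hasDerivAt).deriv]
      ring

lemma anti_of {f T : ℝ → ℝ} {y0 : ℝ} (h0 : 0 < y0)
    (hf : ∀ y, y0 ≤ y → HasDerivAt f (T y / y) y) (hT : ∀ y, y0 ≤ y → T y ≤ 0) :
    AntitoneOn f (Ici y0) := by
  apply antitoneOn_of_deriv_nonpos (convex_Ici y0)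
  · intro y hy; exact (hf y hy).continuousAt.continuousWithinAt
  · intro y hy
    rw [interior_Ici] at hy
    exact (hf y (le_of_lt hy)).differentiableAt.differentiableWithinAt
  · intro y hy
    rw [interior_Ici] at hy
    have hy' : y0 ≤ y := le_of_lt hy
    rw [(hf y hy').deriv]
    exact div_nonpos_of_nonpos_of_nonneg (hT y hy') (by linarith)

lemma theta_rpow (a : ℝ) {y : ℝ} (hy : 0 < y) :
    HasDerivAt (fun y : ℝ => y ^ a) ((a * y ^ a) / y) y := by
  have := Real.hasDerivAt_rpow_const (x := y) (p := a) (Or.inl hy.ne')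
  rw [Real.rpow_sub_one hy.ne'] at this
  exact this.congr_deriv (by ring)

/-- integrate a decaying derivative from infinity -/
lemma int_infty {h T : ℝ → ℝ} {y0 a C : ℝ} (h0 : 0 < y0) (ha : 0 < a)
    (hh : ∀ y, y0 ≤ y → HasDerivAt h (T y / y) y) (hT : ∀ y, y0 ≤ y → -(C * y ^ (-a)) ≤ T y)
    (hlim : Tendsto h atTop (𝓝 0)) : ∀ y, y0 ≤ y → h y ≤ C / a * y ^ (-a) := by
  have key : AntitoneOn (fun y => C / a * y ^ (-a) - h y) (Ici y0) := by
    refine anti_of (T := fun y => -(C * y ^ (-a)) - T y) h0 ?_ ?_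
    · intro y hy
      have hy0 : 0 < y := by linarith
      refine (((theta_rpow (-a) hy0).const_mul (C / a)).sub (hh y hy)).congr_deriv ?_
      field_simp
    · intro y hy; linarith [hT y hy]
  have hl : Tendsto (fun y => C / a * y ^ (-a) - h y) atTop (𝓝 (C / a * 0 - 0)) :=
    ((tendsto_rpow_neg_atTop ha).const_mul _).sub hlim
  intro y hy
  have : C / a * 0 - 0 ≤ C / a * y ^ (-a) - h y := by
    refine le_of_tendsto hl ?_
    filter_upwards [eventually_ge_atTop y] with z hz
    exact key hy (le_trans hy hz) hz
  linarith

/-- Gronwall -/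
lemma gron {ρ T : ℝ → ℝ} {y0 g δ C : ℝ} (h0 : 0 < y0) (hg : g < δ)
    (hρ : ∀ y, y0 ≤ y → HasDerivAt ρ (T y / y) y)
    (hT : ∀ y, y0 ≤ y → T y ≤ -δ * ρ y + C * y ^ (-g)) :
    ∃ C', 0 ≤ C' ∧ ∀ y, y0 ≤ y → ρ y ≤ C / (δ - g) * y ^ (-g) + C' * y ^ (-δ) := by
  have hdg : 0 < δ - g := by linarith
  have key : AntitoneOn (fun y => y ^ δ * ρ y - C / (δ - g) * y ^ (δ - g)) (Ici y0) := by
    refine anti_of (T := fun y => y ^ δ * (δ * ρ y + T y - C * y ^ (-g))) h0 ?_ ?_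
    · intro y hy
      have hy0 : 0 < y := by linarith
      refine (((theta_rpow δ hy0).mul (hρ y hy)).sub
        ((theta_rpow (δ - g) hy0).const_mul (C / (δ - g)))).congr_deriv ?_
      rw [show δ - g = δ + -g by ring] at *
      rw [Real.rpow_add hy0]
      field_simp
    · intro y hy
      have hy0 : 0 < y := by linarith
      exact mul_nonpos_of_nonneg_of_nonpos (by positivity) (by linarith [hT y hy])
  refine ⟨|y0 ^ δ * ρ y0 - C / (δ - g) * y0 ^ (δ - g)|, abs_nonneg _, fun y hy => ?_⟩
  have hy0 : 0 < y := by linarith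
  have h1 := (key self_mem_Ici hy hy).trans (le_abs_self _)
  simp only at h1
  set D := |y0 ^ δ * ρ y0 - C / (δ - g) * y0 ^ (δ - g)|
  have h2 : y ^ (-δ) * (y ^ δ * ρ y - C / (δ - g) * y ^ (δ - g)) ≤ y ^ (-δ) * D :=
    mul_le_mul_of_nonneg_left h1 (by positivity)
  have e1 : y ^ (-δ) * y ^ δ = 1 := by rw [← Real.rpow_add hy0]; simp
  have e2 : y ^ (-δ) * y ^ (δ - g) = y ^ (-g) := by
    rw [← Real.rpow_add hy0]; congr 1; ring
  have e3 : y ^ (-δ) * (y ^ δ * ρ y - C / (δ - g) * y ^ (δ - g))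
    = (y ^ (-δ) * y ^ δ) * ρ y - C / (δ - g) * (y ^ (-δ) * y ^ (δ - g)) := by ring
  rw [e3, e1, e2] at h2
  linarith

lemma isBigO_of_le {f : ℝ → ℝ} {y0 C a : ℝ} (hf : ∀ y, y0 ≤ y → 0 ≤ f y)
    (h : ∀ y, y0 ≤ y → f y ≤ C * y ^ (-a)) : f =O[atTop] fun y : ℝ => y ^ (-a) := by
  refine IsBigO.of_bound C ?_
  filter_upwards [eventually_ge_atTop y0, eventually_gt_atTop 0] with y hy hy0
  rw [Real.norm_of_nonneg (hf y hy), Real.norm_of_nonneg (by positivity)]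
  exact h y hy

section decay
variable {w ρ h ψ : ℝ → ℝ} {α δ K M : ℝ}

lemma rho_small (hδ : 0 < δ)
    (hρ : ∀ y, 0 < y → HasDerivAt ρ ((-(ρ y * (ρ y + δ)) + h y) / y) y)
    (hlim : Tendsto h atTop (𝓝 0)) {ε : ℝ} (hε : 0 < ε) :
    ∃ y0, 1 ≤ y0 ∧ ∀ y, y0 ≤ y → ρ y ≤ ε := by
  have h1 : ∀ᶠ y in atTop, h y < δ * ε / 2 := hlim.eventually_lt_const (by positivity)
  obtain ⟨y1, hy1⟩ := eventually_atTop.1 h1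
  have hy0 : (0:ℝ) < max y1 1 := lt_of_lt_of_le one_pos (le_max_right _ _)
  obtain ⟨C', hC', hb⟩ := gron (C := δ * ε / 2) (g := 0) hy0 hδ
    (fun y hy => hρ y (hy0.trans_le hy)) (fun y hy => by
      have := hy1 y ((le_max_left _ _).trans hy)
      simp only [neg_zero, Real.rpow_zero, mul_one]
      nlinarith [sq_nonneg (ρ y)])
  have h2 : ∀ᶠ y : ℝ in atTop, C' * y ^ (-δ) < ε / 2 := by
    have := (tendsto_rpow_neg_atTop hδ).const_mul C'
    rw [mul_zero] at this
    exact this.eventually_lt_const (by positivity)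
  obtain ⟨y2, hy2⟩ := eventually_atTop.1 h2
  refine ⟨max (max y1 1) y2, (le_max_right _ _).trans (le_max_left _ _), fun y hy => ?_⟩
  have a1 := hb y ((le_max_left _ _).trans hy)
  have a2 := hy2 y ((le_max_right _ _).trans hy)
  simp only [neg_zero, Real.rpow_zero, mul_one, sub_zero] at a1
  have : δ * ε / 2 / δ = ε / 2 := by field_simp
  linarith

lemma w_bound1 (hw : ∀ y, 0 < y → HasDerivAt w ((ρ y - α) * w y / y) y)
    (hwp : ∀ y, 0 < y → 0 < w y) {a y0 : ℝ} (h0 : 0 < y0) (hr : ∀ y, y0 ≤ y → ρ y ≤ α - a) :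
    ∃ C, 0 ≤ C ∧ ∀ y, y0 ≤ y → w y ≤ C * y ^ (-a) := by
  have key : AntitoneOn (fun y => y ^ a * w y) (Ici y0) := by
    refine anti_of (T := fun y => (ρ y - (α - a)) * (y ^ a * w y)) h0 ?_ ?_
    · intro y hy
      have hy0 : 0 < y := by linarith
      refine ((theta_rpow a hy0).mul (hw y hy0)).congr_deriv ?_
      field_simp; ring
    · intro y hy
      have hy0 : 0 < y := by linarith
      have := hwp y hy0
      exact mul_nonpos_of_nonpos_of_nonneg (by linarith [hr y hy]) (by positivity)
  have := hwp y0 h0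
  refine ⟨y0 ^ a * w y0, by positivity, fun y hy => ?_⟩
  have hy0 : 0 < y := by linarith
  have h1 := key self_mem_Ici hy hy
  simp only at h1
  rw [Real.rpow_neg hy0.le, ← div_eq_mul_inv, le_div_iff₀ (by positivity)]
  linarith

lemma w_bound2 (hw : ∀ y, 0 < y → HasDerivAt w ((ρ y - α) * w y / y) y)
    (hwp : ∀ y, 0 < y → 0 < w y) {g D y0 : ℝ} (h0 : 0 < y0) (hg : 0 < g) (hD : 0 ≤ D)
    (hr : ∀ y, y0 ≤ y → ρ y ≤ D * y ^ (-g)) :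
    ∃ C, 0 ≤ C ∧ ∀ y, y0 ≤ y → w y ≤ C * y ^ (-α) := by
  have key : AntitoneOn (fun y => y ^ α * w y * Real.exp (D / g * y ^ (-g))) (Ici y0) := by
    refine anti_of (T := fun y => (ρ y - D * y ^ (-g)) *
      (y ^ α * w y * Real.exp (D / g * y ^ (-g)))) h0 ?_ ?_
    · intro y hy
      have hy0 : 0 < y := by linarith
      refine (((theta_rpow α hy0).mul (hw y hy0)).mul
        (((theta_rpow (-g) hy0).const_mul (D / g)).exp)).congr_deriv ?_
      simp only [Pi.mul_apply]
      field_simp; ring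
    · intro y hy
      have hy0 : 0 < y := by linarith
      have := hwp y hy0
      exact mul_nonpos_of_nonpos_of_nonneg (by linarith [hr y hy]) (by positivity)
  have := hwp y0 h0
  refine ⟨y0 ^ α * w y0 * Real.exp (D / g * y0 ^ (-g)), by positivity, fun y hy => ?_⟩
  have hy0 : 0 < y := by linarith
  have h1 := key self_mem_Ici hy hy
  simp only at h1
  have hwy := hwp y hy0
  have h2 : y ^ α * w y * 1 ≤ y ^ α * w y * Real.exp (D / g * y ^ (-g)) :=
    mul_le_mul_of_nonneg_left (Real.one_le_exp (by positivity)) (by positivity)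
  rw [Real.rpow_neg hy0.le, ← div_eq_mul_inv, le_div_iff₀ (by positivity)]
  linarith

lemma h_bound (hK : 0 ≤ K) (hwp : ∀ y, 0 < y → 0 < w y)
    (hψ : ∀ y, 1 ≤ y → 0 ≤ ψ y ∧ ψ y ≤ M)
    (hh : ∀ y, 0 < y → HasDerivAt h (-(K * ψ y * w y) / y) y)
    (hlim : Tendsto h atTop (𝓝 0)) {a y0 C : ℝ} (h0 : 1 ≤ y0) (ha : 0 < a)
    (hwb : ∀ y, y0 ≤ y → w y ≤ C * y ^ (-a)) :
    ∀ y, y0 ≤ y → h y ≤ K * M * C / a * y ^ (-a) := by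
  refine int_infty (by linarith) ha (fun y hy => hh y (by linarith)) (fun y hy => ?_) hlim
  obtain ⟨b1, b2⟩ := hψ y (h0.trans hy)
  have b3 := hwb y hy
  have b4 := hwp y (by linarith)
  have : K * (ψ y * w y) ≤ K * (M * (C * y ^ (-a))) :=
    mul_le_mul_of_nonneg_left (mul_le_mul b2 b3 b4.le (b1.trans b2)) hK
  nlinarith

lemma rho_bound
    (hρ : ∀ y, 0 < y → HasDerivAt ρ ((-(ρ y * (ρ y + δ)) + h y) / y) y)
    {a g y0 C : ℝ} (h0 : 1 ≤ y0) (hC : 0 ≤ C) (hga : g ≤ a) (hgd : g < δ)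
    (hhb : ∀ y, y0 ≤ y → h y ≤ C * y ^ (-a)) :
    ∃ D, 0 ≤ D ∧ ∀ y, y0 ≤ y → ρ y ≤ D * y ^ (-g) := by
  obtain ⟨C', hC', hb⟩ := gron (C := C) (g := g) (y0 := y0) (by linarith) hgd
    (fun y hy => hρ y (by linarith)) (fun y hy => by
      have h1 := hhb y hy
      have h2 : y ^ (-a) ≤ y ^ (-g) :=
        Real.rpow_le_rpow_of_exponent_le (h0.trans hy) (by linarith)
      have h3 := mul_le_mul_of_nonneg_left h2 hC
      nlinarith [sq_nonneg (ρ y)])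
  refine ⟨C / (δ - g) + C', add_nonneg (div_nonneg hC (by linarith)) hC', fun y hy => ?_⟩
  have h2 : y ^ (-δ) ≤ y ^ (-g) :=
    Real.rpow_le_rpow_of_exponent_le (h0.trans hy) (by linarith)
  have h3 := mul_le_mul_of_nonneg_left h2 hC'
  linarith [hb y hy]

lemma decay (hα : 0 < α) (hδ : 0 < δ) (hK : 0 ≤ K)
    (hw : ∀ y, 0 < y → HasDerivAt w ((ρ y - α) * w y / y) y)
    (hρ : ∀ y, 0 < y → HasDerivAt ρ ((-(ρ y * (ρ y + δ)) + h y) / y) y)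
    (hh : ∀ y, 0 < y → HasDerivAt h (-(K * ψ y * w y) / y) y)
    (hwp : ∀ y, 0 < y → 0 < w y) (hρp : ∀ y, 0 < y → 0 ≤ ρ y) (hhp : ∀ y, 0 < y → 0 ≤ h y)
    (hψ : ∀ y, 1 ≤ y → 0 ≤ ψ y ∧ ψ y ≤ M) (hlim : Tendsto h atTop (𝓝 0)) :
    (w =O[atTop] fun y : ℝ => y ^ (-α)) ∧ (h =O[atTop] fun y : ℝ => y ^ (-α)) ∧
    ∀ g, g < min α δ → ρ =O[atTop] fun y : ℝ => y ^ (-g) := by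
  have hM : 0 ≤ M := (hψ 1 le_rfl).1.trans (hψ 1 le_rfl).2
  obtain ⟨y0, h0, hr⟩ := rho_small hδ hρ hlim (show 0 < α / 2 by linarith)
  have h0' : 0 < y0 := by linarith
  obtain ⟨C1, hC1, hw1⟩ := w_bound1 (a := α / 2) hw hwp h0' (fun y hy => by linarith [hr y hy])
  have hh1 := h_bound hK hwp hψ hh hlim h0 (by linarith) hw1
  have hm : 0 < min (α / 2) (δ / 2) := lt_min (by linarith) (by linarith)
  obtain ⟨D, hD, hρ1⟩ := rho_bound (g := min (α / 2) (δ / 2)) hρ h0 (by positivity)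
    (min_le_left _ _) (lt_of_le_of_lt (min_le_right _ _) (by linarith)) hh1
  obtain ⟨C2, hC2, hw2⟩ := w_bound2 hw hwp h0' hm hD hρ1
  have hh2 := h_bound hK hwp hψ hh hlim h0 hα hw2
  refine ⟨isBigO_of_le (fun y hy => (hwp y (by linarith)).le) hw2,
    isBigO_of_le (fun y hy => hhp y (by linarith)) hh2, fun g hg => ?_⟩
  obtain ⟨D2, hD2, hρ2⟩ := rho_bound (g := g) hρ h0 (by positivity)
    (hg.le.trans (min_le_left _ _)) (hg.trans_le (min_le_right _ _)) hh2
  exact isBigO_of_le (fun y hy => hρp y (by linarith)) hρ2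

lemma Sym.succ_of {n : ℕ} {β : ℝ} {f T : ℝ → ℝ} (hf : ∀ y, 0 < y → HasDerivAt f (T y / y) y)
    (hO : f =O[atTop] fun y : ℝ => y ^ (-β)) (hT : Sym n β T) : Sym (n+1) β f := by
  refine ⟨fun y hy => (hf y hy).differentiableAt, hO, hT.congr fun y hy => ?_⟩
  rw [(hf y hy).deriv]; field_simp

lemma sym_system {φ : ℝ → ℝ} {p g : ℝ} (hα : 0 < α) (hg : 0 < g) (hgα : g ≤ α)
    (hφ : ∀ y, 0 < y → HasDerivAt φ (w y / y) y)
    (hw : ∀ y, 0 < y → HasDerivAt w ((ρ y - α) * w y / y) y)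
    (hρ : ∀ y, 0 < y → HasDerivAt ρ ((-(ρ y * (ρ y + δ)) + h y) / y) y)
    (hh : ∀ y, 0 < y → HasDerivAt h (-(K * (φ y) ^ (p - 2) * w y) / y) y)
    (hφp : ∀ y, 0 < y → 0 < φ y)
    (hφO : ∀ s : ℝ, (fun y => φ y ^ s) =O[atTop] fun y : ℝ => y ^ (-(0:ℝ)))
    (hwO : w =O[atTop] fun y : ℝ => y ^ (-α)) (hhO : h =O[atTop] fun y : ℝ => y ^ (-α))
    (hρO : ρ =O[atTop] fun y : ℝ => y ^ (-g)) (n : ℕ) :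
    Sym n α w ∧ Sym n g ρ ∧ Sym n α h ∧ ∀ s : ℝ, Sym n 0 (fun y => φ y ^ s) := by
  induction n with
  | zero => exact ⟨hwO, hρO, hhO, hφO⟩
  | succ n ih =>
    obtain ⟨i1, i2, i3, i4⟩ := ih
    refine ⟨Sym.succ_of hw hwO ?_, Sym.succ_of hρ hρO ?_, Sym.succ_of hh hhO ?_, fun s =>
      Sym.succ_of (T := fun y => s * (φ y ^ (s - 1) * w y)) ?_ (hφO s) ?_⟩
    · refine (((i2.mul i1).mono (by linarith)).add (i1.const_mul (-α))).congr ?_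
      intro y hy; ring
    · refine ((((i2.mul i2).const_mul (-1)).mono (by linarith)).add
        ((i2.const_mul (-δ)).add (i3.mono hgα))).congr ?_
      intro y hy; ring
    · have := ((i4 (p-2)).mul i1).const_mul (-K)
      rw [zero_add] at this
      exact this.congr (fun y hy => by ring)
    · intro y hy
      refine ((hφ y hy).rpow_const (Or.inl (hφp y hy).ne')).congr_deriv ?_
      ring
    · exact (((i4 (s-1)).mul i1).const_mul s).mono (by linarith)
end decay

section conv
variable {φ w : ℝ → ℝ} {p b B : ℝ}

lemma phi_mono (hφ : ∀ y, 0 < y → HasDerivAt φ (w y / y) y) (hwp : ∀ y, 0 < y → 0 < w y)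
    {x y : ℝ} (hx : 0 < x) (hxy : x ≤ y) : φ x ≤ φ y := by
  have := anti_of (f := fun y => - φ y) (T := fun y => - w y) hx (fun y hy => by
    have hy0 : 0 < y := by linarith
    exact (hφ y hy0).fun_neg.congr_deriv (by ring)) (fun y hy => by
      have := hwp y (by linarith); linarith)
  have := this self_mem_Ici hxy hxy
  simp only at this; linarith

lemma phi_le (hp : 1 < p) (hb : 0 < b)
    (hφ : ∀ y, 0 < y → HasDerivAt φ (w y / y) y)
    (hw : ∀ y, 0 < y → HasDerivAt w ((-b * w y + φ y * (B - φ y ^ (p - 1))) / y) y)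
    (hφp : ∀ y, 0 < y → 0 < φ y) (hwp : ∀ y, 0 < y → 0 < w y) :
    ∀ y, 0 < y → φ y ^ (p - 1) ≤ B := by
  intro y0 h0
  by_contra hcon
  push Not at hcon
  have hφ0 := hφp y0 h0
  have hκ : 0 < φ y0 * (φ y0 ^ (p - 1) - B) := mul_pos hφ0 (by linarith)
  set κ := φ y0 * (φ y0 ^ (p - 1) - B) with hκd
  have key : AntitoneOn (fun y => w y + κ * Real.log y) (Ici y0) := by
    refine anti_of (T := fun y => -b * w y + φ y * (B - φ y ^ (p - 1)) + κ) h0 ?_ ?_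
    · intro y hy
      have hy0 : 0 < y := by linarith
      refine ((hw y hy0).add ((Real.hasDerivAt_log hy0.ne').const_mul κ)).congr_deriv ?_
      field_simp
    · intro y hy
      have hy0 : 0 < y := by linarith
      have h1 := phi_mono hφ hwp h0 hy
      have h2 : φ y0 ^ (p - 1) ≤ φ y ^ (p - 1) :=
        Real.rpow_le_rpow hφ0.le h1 (by linarith)
      have h3 : κ ≤ φ y * (φ y ^ (p - 1) - B) :=
        mul_le_mul h1 (by linarith) (by linarith) (hφp y hy0).le
      have h4 := mul_pos hb (hwp y hy0)
      linarith
  have hl : Tendsto (fun y => κ * Real.log y) atTop atTop :=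
    Real.tendsto_log_atTop.const_mul_atTop hκ
  obtain ⟨y, hy1, hy2⟩ := ((hl.eventually_ge_atTop (w y0 + κ * Real.log y0)).and
    (eventually_ge_atTop y0)).exists
  have := key self_mem_Ici hy2 hy2
  simp only at this
  linarith [hwp y (by linarith)]

lemma phi_le' (hp : 1 < p) (hφp : ∀ y, 0 < y → 0 < φ y)
    (hle : ∀ y, 0 < y → φ y ^ (p - 1) ≤ B) : ∀ y, 0 < y → φ y ≤ B ^ (p - 1)⁻¹ := by
  intro y hy
  have h1 : 0 < p - 1 := by linarith
  have h2 := hφp y hy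
  have := Real.rpow_le_rpow (by positivity) (hle y hy) (inv_nonneg.2 h1.le)
  rwa [← Real.rpow_mul h2.le, mul_inv_cancel₀ h1.ne', Real.rpow_one] at this

lemma phi_pow_bdd (hφ : ∀ y, 0 < y → HasDerivAt φ (w y / y) y) (hwp : ∀ y, 0 < y → 0 < w y)
    (hφp : ∀ y, 0 < y → 0 < φ y) {c : ℝ} (hc : ∀ y, 0 < y → φ y ≤ c) (s : ℝ) :
    ∀ y, 1 ≤ y → 0 ≤ φ y ^ s ∧ φ y ^ s ≤ φ 1 ^ s + c ^ s := by
  intro y hy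
  have hy0 : 0 < y := by linarith
  have h1 := hφp y hy0
  have h2 := hφp 1 one_pos
  have h3 := phi_mono hφ hwp one_pos hy
  have h4 := hc y hy0
  have hc0 : 0 < c := h1.trans_le h4
  refine ⟨by positivity, ?_⟩
  have a1 : 0 < φ 1 ^ s := by positivity
  have a2 : 0 < c ^ s := by positivity
  rcases le_total 0 s with hs | hs
  · linarith [Real.rpow_le_rpow h1.le h4 hs]
  · linarith [Real.rpow_le_rpow_of_nonpos h2 h3 hs]

lemma h_lim (hp : 1 < p) (hb : 0 < b)
    (hφ : ∀ y, 0 < y → HasDerivAt φ (w y / y) y)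
    (hw : ∀ y, 0 < y → HasDerivAt w ((-b * w y + φ y * (B - φ y ^ (p - 1))) / y) y)
    (hφp : ∀ y, 0 < y → 0 < φ y) (hwp : ∀ y, 0 < y → 0 < w y) :
    Tendsto (fun y => p * (B - φ y ^ (p - 1))) atTop (𝓝 0) := by
  have hle := phi_le hp hb hφ hw hφp hwp
  have hc := phi_le' hp hφp hle
  set c := B ^ (p - 1)⁻¹
  have main : ∀ ε, 0 < ε → ∃ y, 0 < y ∧ B - φ y ^ (p - 1) < ε := by
    intro ε hε
    by_contra hcon
    push Not at hcon
    have hκ : 0 < φ 1 * ε := mul_pos (hφp 1 one_pos) hε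
    set κ := φ 1 * ε with hκd
    have key : AntitoneOn (fun y => κ * Real.log y - (w y + b * φ y)) (Ici 1) := by
      refine anti_of (T := fun y => κ - φ y * (B - φ y ^ (p - 1))) one_pos ?_ ?_
      · intro y hy
        have hy0 : 0 < y := by linarith
        refine (((Real.hasDerivAt_log hy0.ne').const_mul κ).sub
          ((hw y hy0).add ((hφ y hy0).const_mul b))).congr_deriv ?_
        field_simp
        ring
      · intro y hy
        have hy0 : 0 < y := by linarith
        have h1 := phi_mono hφ hwp one_pos hy
        have h3 : κ ≤ φ y * (B - φ y ^ (p - 1)) :=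
          mul_le_mul h1 (hcon y hy0) hε.le (hφp y hy0).le
        linarith
    have hl : Tendsto (fun y => κ * Real.log y) atTop atTop :=
      Real.tendsto_log_atTop.const_mul_atTop hκ
    obtain ⟨y1, hy1⟩ := eventually_atTop.1 ((hl.eventually_ge_atTop (1 + b * c)).and
      (eventually_ge_atTop 1))
    have hy1' : 0 < max y1 1 := lt_of_lt_of_le one_pos (le_max_right _ _)
    have hw1 : ∀ y, max y1 1 ≤ y → 1 ≤ w y := by
      intro y hy
      obtain ⟨c1, c2⟩ := hy1 y ((le_max_left _ _).trans hy)
      have c3 := key self_mem_Ici c2 c2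
      simp only [Real.log_one, mul_zero] at c3
      have c4 := hwp 1 one_pos
      have c5 := mul_pos hb (hφp 1 one_pos)
      have c6 := mul_le_mul_of_nonneg_left (hc y (by linarith)) hb.le
      linarith
    have key2 : AntitoneOn (fun y => Real.log y - φ y) (Ici (max y1 1)) := by
      refine anti_of (T := fun y => 1 - w y) hy1' ?_ ?_
      · intro y hy
        have hy0 : 0 < y := hy1'.trans_le hy
        refine ((Real.hasDerivAt_log hy0.ne').sub (hφ y hy0)).congr_deriv ?_
        field_simp
      · intro y hy
        linarith [hw1 y hy]
    obtain ⟨y, hya, hyb⟩ := ((Real.tendsto_log_atTop.eventually_ge_atTop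
      (Real.log (max y1 1) + c + 1)).and (eventually_ge_atTop (max y1 1))).exists
    have c3 := key2 self_mem_Ici hyb hyb
    simp only at c3
    linarith [hφp _ hy1', hc y (hy1'.trans_le hyb)]
  have : Tendsto (fun y => B - φ y ^ (p - 1)) atTop (𝓝 0) := by
    rw [tendsto_order]
    constructor
    · intro a ha
      filter_upwards [eventually_gt_atTop 0] with y hy
      linarith [hle y hy]
    · intro a ha
      obtain ⟨y0, h0, h1⟩ := main a ha
      filter_upwards [eventually_ge_atTop y0] with y hy
      have := Real.rpow_le_rpow (hφp y0 h0).le (phi_mono hφ hwp h0 hy) (z := p - 1) (by linarith)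
      linarith
  simpa using this.const_mul p
end conv

lemma params (d : ℕ) (hd : 11 ≤ d) (p : ℝ) (hp1 : 1 < p) (hp : pJL d < p) (m b B : ℝ)
    (hm : m = 2 / (p - 1)) (hb : b = (d:ℝ) - 2 - 2 * m) (hB : B = m * ((d:ℝ) - 2 - m)) :
    0 < m ∧ 0 < b ∧ 0 < B ∧ 0 < alph d p ∧ 0 < alph₂ d p - alph d p ∧
    alph d p * alph₂ d p = (p - 1) * B ∧ alph d p + alph₂ d p = b ∧ gam d p = alph d p + m := by
  have hp0 : 0 < p - 1 := by linarith
  have hm0 : 0 < m := by rw [hm]; positivity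
  have hpm : (p - 1) * m = 2 := by rw [hm]; field_simp
  have hd' : (11:ℝ) ≤ d := by exact_mod_cast hd
  obtain ⟨t, ht⟩ : ∃ t, t = Real.sqrt ((d:ℝ) - 1) := ⟨_, rfl⟩
  have ht2 : t ^ 2 = (d:ℝ) - 1 := by rw [ht, Real.sq_sqrt (by linarith)]
  have ht3 : 3 < t := by rw [ht]; apply Real.lt_sqrt_of_sq_lt; linarith
  have hD : 0 < (d:ℝ) - 4 - 2 * t := by nlinarith
  have h2m : 2 * m < (d:ℝ) - 4 - 2 * t := by
    unfold pJL at hp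
    rw [← ht] at hp
    have : 4 / ((d:ℝ) - 4 - 2 * t) < p - 1 := by linarith
    rw [div_lt_iff₀ hD] at this
    have h4 : (p - 1) * (2 * m) < (p - 1) * ((d:ℝ) - 4 - 2 * t) := by nlinarith
    exact lt_of_mul_lt_mul_left h4 hp0.le
  have hb2 : 2 + 2 * t < b := by rw [hb]; linarith
  have hb0 : 0 < b := by linarith
  have hnm : 0 < (d:ℝ) - 2 - m := by linarith
  have hB0 : 0 < B := by rw [hB]; positivity
  have hcB : cInfty d p ^ (p - 1) = B := by
    unfold cInfty
    rw [← hm, ← hB, ← Real.rpow_mul hB0.le, one_div, inv_mul_cancel₀ hp0.ne', Real.rpow_one]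
  have hpB : (p - 1) * B = 2 * ((d:ℝ) - 2 - m) := by
    rw [hB, ← mul_assoc, hpm]
  have hdis : discr d p = b ^ 2 - 8 * ((d:ℝ) - 2 - m) := by
    unfold discr; rw [hcB]
    have : 4 * p * B = 4 * ((p - 1) * B) + 4 * B := by ring
    rw [this, hpB, hb, hB]; ring
  have hdpos : 0 < discr d p := by
    rw [hdis]
    have : b ^ 2 - 8 * ((d:ℝ) - 2 - m) = (b - 2 - 2 * t) * (b - 2 + 2 * t) := by
      have : (b - 2 - 2 * t) * (b - 2 + 2 * t) = (b - 2) ^ 2 - 4 * t ^ 2 := by ring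
      rw [this, ht2, hb]; ring
    rw [this]
    exact _root_.mul_pos (by linarith) (by linarith)
  obtain ⟨σ, hσ⟩ : ∃ σ, σ = Real.sqrt (discr d p) := ⟨_, rfl⟩
  have hσ0 : 0 < σ := by rw [hσ]; exact Real.sqrt_pos.2 hdpos
  have hσ2 : σ ^ 2 = b ^ 2 - 8 * ((d:ℝ) - 2 - m) := by rw [hσ, Real.sq_sqrt hdpos.le, hdis]
  have hσb : σ < b := by nlinarith
  have hα : alph d p = (b - σ) / 2 := by
    unfold alph gam; rw [← hσ, ← hm, hb]; ring
  have h4 : 4 / (p - 1) = 2 * m := by rw [hm]; ring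
  have hα2 : alph₂ d p = (b + σ) / 2 := by
    unfold alph₂; rw [hα, h4, hb]; ring
  refine ⟨hm0, hb0, hB0, by rw [hα]; linarith, by rw [hα, hα2]; linarith, ?_, ?_, ?_⟩
  · rw [hα, hα2, hpB]; nlinarith
  · rw [hα, hα2]; ring
  · unfold alph; rw [← hm]; ring

lemma contDiffAt_deriv' {f : ℝ → ℝ} {x : ℝ} (hf : ContDiffAt ℝ (⊤ : ℕ∞) f x) :
    ContDiffAt ℝ (⊤ : ℕ∞) (deriv f) x := by
  have h1 : ContDiffAt ℝ (⊤ : ℕ∞) (fderiv ℝ f) x :=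
    hf.fderiv_right (m := (⊤ : ℕ∞)) (by simp)
  have h2 : ContDiffAt ℝ (⊤ : ℕ∞) (fun y => fderiv ℝ f y 1) x := h1.clm_apply contDiffAt_const
  exact h2

lemma near_zero {f : ℝ → ℝ} (k : ℕ) (hf : ContDiffAt ℝ (⊤ : ℕ∞) f 0) :
    (iteratedDeriv k f) =O[𝓝[>] (0:ℝ)] (fun _ : ℝ => (1 : ℝ)) := by
  have h1 : ContinuousAt (iteratedDeriv k f) 0 := by
    induction k generalizing f with
    | zero => simpa using hf.continuousAt
    | succ k ih =>
      rw [iteratedDeriv_succ']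
      exact ih (contDiffAt_deriv' hf)
  exact (h1.tendsto.mono_left nhdsWithin_le_nhds).isBigO_one ℝ

/-- **Asymptotic behaviour of the potentials** `V = pQ^{p-1}` and `W = ∂_y log Λ⁽¹⁾Q`
(Lemma 2.4): there are nonzero coefficients `c_k`, `c'_k` with `c'_0 = -γ` such that for
every `k`: `∂_y^k V`, `∂_y^k W` are `O(1)` as `y → 0`;
`∂_y^k V = c_k y^{-(2+k)} + O(y^{-(2+α+k)})` as `y → ∞`; for every `0 < g < min(α,α₂-α)`,
`∂_y^k W = c'_k y^{-(1+k)} + O(y^{-(1+g+k)})` as `y → ∞`; and the degeneracy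
`∂_y^k (d/dλ[(Q_λ)^{p-1}]|_{λ=1}) = O(y^{-(2+α+k)})` as `y → ∞` holds. -/
theorem potential_asymptotics (d : ℕ) (hd : 11 ≤ d) (p : ℝ) (hp1 : 1 < p) (hp : pJL d < p)
    (Q : ℝ → ℝ) (hQ : IsGroundState d p Q)
    (hpos : ∀ y : ℝ, 0 ≤ y → 0 < Lam1 p Q y) :
    ∃ c c' : ℕ → ℝ,
      (∀ k : ℕ, c k ≠ 0 ∧ c' k ≠ 0) ∧ c' 0 = -(gam d p) ∧
      -- (i) boundedness near the origin
      (∀ k : ℕ,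
        ((iteratedDeriv k (fun y : ℝ => p * Q y ^ (p - 1))) =O[𝓝[>] (0:ℝ)]
          (fun _ : ℝ => (1 : ℝ))) ∧
        ((iteratedDeriv k (Wpot p Q)) =O[𝓝[>] (0:ℝ)] (fun _ : ℝ => (1 : ℝ)))) ∧
      -- (i) expansion of V at infinity
      (∀ k : ℕ,
        (fun y : ℝ => iteratedDeriv k (fun z : ℝ => p * Q z ^ (p - 1)) y -
            c k * y ^ (-(2 + (k : ℝ))))
          =O[atTop] fun y : ℝ => y ^ (-(2 + alph d p + (k : ℝ)))) ∧
      -- (i) expansion of W at infinity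
      (∀ g : ℝ, 0 < g → g < min (alph d p) (alph₂ d p - alph d p) → ∀ k : ℕ,
        (fun y : ℝ => iteratedDeriv k (Wpot p Q) y - c' k * y ^ (-(1 + (k : ℝ))))
          =O[atTop] fun y : ℝ => y ^ (-(1 + g + (k : ℝ)))) ∧
      -- (ii) degeneracy of the scaling derivative of the potential
      (∀ k : ℕ,
        (iteratedDeriv k
            (fun y : ℝ => deriv (fun lam : ℝ => (lam ^ (2 / (p - 1)) * Q (lam * y)) ^ (p - 1)) 1))
          =O[atTop] fun y : ℝ => y ^ (-(2 + alph d p + (k : ℝ)))) := by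
  obtain ⟨m, hm⟩ : ∃ m, m = 2 / (p - 1) := ⟨_, rfl⟩
  obtain ⟨b, hb⟩ : ∃ b, b = (d:ℝ) - 2 - 2 * m := ⟨_, rfl⟩
  obtain ⟨B, hB⟩ : ∃ B, B = m * ((d:ℝ) - 2 - m) := ⟨_, rfl⟩
  obtain ⟨hm0, hb0, hB0, hα, hδ, hprod, hsum, hgam⟩ := params d hd p hp1 hp m b B hm hb hB
  have hp0 : 0 < p - 1 := by linarith
  have hmp : m * (p - 1) = 2 := by rw [hm]; field_simp
  have hQd : ∀ y, HasDerivAt Q (deriv Q y) y := fun y =>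
    (hQ.smooth.differentiable (by simp) y).hasDerivAt
  have hQs : ContDiff ℝ (⊤ : ℕ∞) (deriv Q) := by
    rw [contDiff_iff_contDiffAt]; intro x; exact contDiffAt_deriv' hQ.smooth.contDiffAt
  have hQdd : ∀ y, HasDerivAt (deriv Q) (deriv (deriv Q) y) y := fun y =>
    (hQs.differentiable (by simp) y).hasDerivAt
  have hGs : ContDiff ℝ (⊤ : ℕ∞) (Lam1 p Q) :=
    (contDiff_const.mul hQ.smooth).add (contDiff_id.mul hQs)
  have hGe : ∀ y, Lam1 p Q y = m * Q y + y * deriv Q y := fun y => by unfold Lam1; rw [hm]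
  have hGd : ∀ y, HasDerivAt (Lam1 p Q)
      (m * deriv Q y + (deriv Q y + y * deriv (deriv Q) y)) y := fun y => by
    have h1 := ((hQd y).const_mul m).fun_add ((hasDerivAt_id y).fun_mul (hQdd y))
    have h2 : Lam1 p Q = fun y => m * Q y + id y * deriv Q y := by
      funext y; rw [hGe]; rfl
    rw [h2]
    exact h1.congr_deriv (by simp)
  obtain ⟨φ, hφe⟩ : ∃ φ : ℝ → ℝ, φ = fun y => y ^ m * Q y := ⟨_, rfl⟩
  obtain ⟨w, hwe⟩ : ∃ w : ℝ → ℝ, w = fun y => y ^ m * Lam1 p Q y := ⟨_, rfl⟩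
  have hφp : ∀ y, 0 < y → 0 < φ y := fun y hy => by
    have := hQ.pos y hy.le
    rw [hφe]; positivity
  have hwp : ∀ y, 0 < y → 0 < w y := fun y hy => by
    have := hpos y hy.le
    rw [hwe]; positivity
  have hφX : ∀ y, 0 < y → φ y ^ (p - 1) = y ^ 2 * Q y ^ (p - 1) := fun y hy => by
    rw [hφe]
    simp only
    rw [Real.mul_rpow (by positivity) (hQ.pos y hy.le).le, ← Real.rpow_mul hy.le, hmp,
      Real.rpow_two]
  have hφ : ∀ y, 0 < y → HasDerivAt φ (w y / y) y := fun y hy => by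
    rw [hφe, hwe]
    refine ((theta_rpow m hy).fun_mul (hQd y)).congr_deriv ?_
    simp only [hGe]; field_simp
  have hw : ∀ y, 0 < y →
      HasDerivAt w ((-b * w y + φ y * (B - φ y ^ (p - 1))) / y) y := fun y hy => by
    rw [hφX y hy, hφe, hwe]
    refine ((theta_rpow m hy).fun_mul (hGd y)).congr_deriv ?_
    have hode := hQ.ode y hy
    have hQp : Q y ^ p = Q y * Q y ^ (p - 1) := by
      rw [Real.rpow_sub_one (hQ.pos y hy.le).ne']
      have := (hQ.pos y hy.le).ne'
      field_simp
    rw [hQp] at hode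
    have e : deriv (deriv Q) y = - (((d : ℝ) - 1) / y * deriv Q y) - Q y * Q y ^ (p - 1) := by
      linarith
    simp only [e, hGe, hb, hB]
    field_simp
    ring
  have hle := phi_le hp1 hb0 hφ hw hφp hwp
  have hc := phi_le' hp1 hφp hle
  have hlim := h_lim hp1 hb0 hφ hw hφp hwp
  obtain ⟨α, hαe⟩ : ∃ α, α = alph d p := ⟨_, rfl⟩
  obtain ⟨α₂, hα₂e⟩ : ∃ α₂, α₂ = alph₂ d p := ⟨_, rfl⟩
  rw [← hαe] at hα hδ hprod hsum hgam ⊢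
  rw [← hα₂e] at hδ hprod hsum ⊢
  obtain ⟨h, hhe⟩ : ∃ h : ℝ → ℝ, h = fun y => p * (B - φ y ^ (p - 1)) := ⟨_, rfl⟩
  obtain ⟨N, hNe⟩ : ∃ N : ℝ → ℝ, N = fun y => -b * w y + φ y * (B - φ y ^ (p - 1)) := ⟨_, rfl⟩
  obtain ⟨ρ, hρe⟩ : ∃ ρ : ℝ → ℝ, ρ = fun y => N y / w y + α := ⟨_, rfl⟩
  rw [← hhe] at hlim
  have hφ1 : ∀ y, 0 < y → HasDerivAt (fun y => φ y ^ (p - 1))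
      ((p - 1) * φ y ^ (p - 2) * w y / y) y := fun y hy => by
    refine ((hφ y hy).rpow_const (Or.inl (hφp y hy).ne')).congr_deriv ?_
    rw [show p - 1 - 1 = p - 2 by ring]; ring
  have hφ2 : ∀ y, 0 < y → φ y * φ y ^ (p - 2) = φ y ^ (p - 1) := fun y hy => by
    rw [show p - 2 = p - 1 - 1 by ring, Real.rpow_sub_one (hφp y hy).ne']
    have := (hφp y hy).ne'
    field_simp
  have hh : ∀ y, 0 < y →
      HasDerivAt h (-((p * (p - 1)) * φ y ^ (p - 2) * w y) / y) y := fun y hy => by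
    rw [hhe]
    refine (((hφ1 y hy).const_sub B).const_mul p).congr_deriv ?_
    ring
  have hhp : ∀ y, 0 < y → 0 ≤ h y := fun y hy => by
    rw [hhe]; exact mul_nonneg (by linarith) (by linarith [hle y hy])
  have hwN : ∀ y, 0 < y → HasDerivAt w (N y / y) y := fun y hy => by
    rw [hNe]; exact hw y hy
  have hN : ∀ y, 0 < y →
      HasDerivAt N ((-b * N y + w y * (h y - α * α₂)) / y) y := fun y hy => by
    have h1 := ((hwN y hy).const_mul (-b)).fun_add ((hφ y hy).fun_mul ((hφ1 y hy).const_sub B))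
    rw [← hNe] at h1
    refine h1.congr_deriv ?_
    have e := hφ2 y hy
    rw [hprod]
    have e2 : φ y * -((p - 1) * φ y ^ (p - 2) * w y / y)
        = -((p - 1) * (φ y * φ y ^ (p - 2)) * w y / y) := by ring
    rw [e2, e, hhe]
    field_simp
    ring
  have hwρ : ∀ y, 0 < y → HasDerivAt w ((ρ y - α) * w y / y) y := fun y hy => by
    refine (hwN y hy).congr_deriv ?_
    have := (hwp y hy).ne'
    rw [hρe]; field_simp; ring
  have hρ : ∀ y, 0 < y →
      HasDerivAt ρ ((-(ρ y * (ρ y + (α₂ - α))) + h y) / y) y := fun y hy => by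
    have hw0 := (hwp y hy).ne'
    have h1 := ((hN y hy).fun_div (hwN y hy) hw0).add_const α
    rw [← hρe] at h1
    refine h1.congr_deriv ?_
    rw [hρe, ← hsum]
    field_simp
    ring
  have hρp : ∀ y, 0 < y → 0 ≤ ρ y := by
    have hα₂0 : 0 < α₂ := by linarith
    have hFc : Continuous (fun y => y ^ α₂ * (N y + α * w y)) := by
      have cφ : Continuous φ := by
        rw [hφe]; exact (Real.continuous_rpow_const hm0.le).mul hQ.smooth.continuous
      have cw : Continuous w := by
        rw [hwe]; exact (Real.continuous_rpow_const hm0.le).mul hGs.continuous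
      have cN : Continuous N := by
        rw [hNe]
        exact (continuous_const.mul cw).add (cφ.mul (continuous_const.sub
          (cφ.rpow_const (fun _ => Or.inr hp0.le))))
      exact (Real.continuous_rpow_const hα₂0.le).mul (cN.add (continuous_const.mul cw))
    have hFd : ∀ y, 0 < y → HasDerivAt (fun y => y ^ α₂ * (N y + α * w y))
        (y ^ α₂ * (h y * w y) / y) y := fun y hy => by
      refine ((theta_rpow α₂ hy).fun_mul
        ((hN y hy).fun_add ((hwN y hy).const_mul α))).congr_deriv ?_
      rw [← hsum]
      field_simp
      ring
    have hmono : MonotoneOn (fun y => y ^ α₂ * (N y + α * w y)) (Ici 0) := by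
      apply monotoneOn_of_deriv_nonneg (convex_Ici 0) hFc.continuousOn
      · intro y hy
        rw [interior_Ici] at hy
        exact (hFd y hy).differentiableAt.differentiableWithinAt
      · intro y hy
        rw [interior_Ici] at hy
        have hy0 : 0 < y := hy
        rw [(hFd y hy).deriv]
        have := hhp y hy0
        have := hwp y hy0
        positivity
    intro y hy
    have h1 := hmono self_mem_Ici hy.le hy.le
    simp only [Real.zero_rpow hα₂0.ne', zero_mul] at h1
    have h2 : 0 ≤ N y + α * w y := by
      have : 0 < y ^ α₂ := by positivity
      exact nonneg_of_mul_nonneg_right h1 this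
    have h3 := hwp y hy
    have : ρ y = (N y + α * w y) / w y := by rw [hρe]; field_simp
    rw [this]; positivity
  have hφb := phi_pow_bdd hφ hwp hφp hc
  obtain ⟨hwO, hhO, hρO⟩ := decay (ψ := fun y => φ y ^ (p - 2)) hα hδ
    (show 0 ≤ p * (p - 1) from mul_nonneg (by linarith) hp0.le) hwρ hρ hh hwp hρp hhp
    (hφb (p - 2)) hlim
  have hφO : ∀ s : ℝ, (fun y => φ y ^ s) =O[atTop] fun y : ℝ => y ^ (-(0:ℝ)) := fun s =>
    isBigO_of_le (y0 := 1) (C := φ 1 ^ s + (B ^ (p - 1)⁻¹) ^ s) (fun y hy => (hφb s y hy).1)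
      (fun y hy => by simpa using (hφb s y hy).2)
  have sys : ∀ g, 0 < g → g < min α (α₂ - α) → ∀ n, Sym n α w ∧ Sym n g ρ ∧ Sym n α h ∧
      ∀ s : ℝ, Sym n 0 (fun y => φ y ^ s) := fun g hg hg2 n =>
    sym_system (p := p) hα hg (hg2.le.trans (min_le_left _ _)) hφ hwρ hρ hh hφp hφO hwO hhO
      (hρO g hg2) n
  have hmin : 0 < min α (α₂ - α) := lt_min hα hδ
  have sys0 := sys (min α (α₂ - α) / 2) (by linarith) (by linarith)
  have hWe : ∀ y, 0 < y → Wpot p Q y = -(gam d p) * y ^ (-1:ℝ) + y ^ (-1:ℝ) * ρ y := by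
    intro y hy
    have h1 : ∀ z, 0 < z → Real.log (Lam1 p Q z) = Real.log (w z) - m * Real.log z := by
      intro z hz
      rw [hwe]
      simp only
      rw [Real.log_mul (by positivity) (hpos z hz.le).ne', Real.log_rpow hz]; ring
    unfold Wpot
    rw [deriv_congr_pos h1 hy, (((hwρ y hy).log (hwp y hy).ne').fun_sub
      ((Real.hasDerivAt_log hy.ne').const_mul m)).deriv, hgam, Real.rpow_neg_one]
    have := (hwp y hy).ne'
    field_simp
    ring
  have hVe : ∀ y, 0 < y → p * Q y ^ (p - 1) = (p * B) * y ^ (-2:ℝ) +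
      (-1) * (y ^ (-2:ℝ) * h y) := by
    intro y hy
    rw [hhe]
    simp only
    rw [hφX y hy, Real.rpow_neg hy.le, Real.rpow_two]
    field_simp
    ring
  have hDe : ∀ y, 0 < y →
      deriv (fun lam : ℝ => (lam ^ m * Q (lam * y)) ^ (p - 1)) 1
        = 0 * y ^ (0:ℝ) + (p - 1) * (y ^ (-2:ℝ) * (φ y ^ (p - 2) * w y)) := by
    intro y hy
    have hQy := hQ.pos y hy.le
    have h1 : HasDerivAt (fun lam : ℝ => lam * y) y 1 := by
      simpa using (hasDerivAt_id (1:ℝ)).mul_const y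
    have h2 : HasDerivAt (fun lam : ℝ => Q (lam * y)) (deriv Q y * y) 1 := by
      have h3 : HasDerivAt Q (deriv Q y) ((fun lam : ℝ => lam * y) 1) := by simpa using hQd y
      exact h3.comp 1 h1
    have h4 := (theta_rpow m one_pos).fun_mul h2
    have h5 := h4.rpow_const (p := p - 1) (Or.inl (by simpa using hQy.ne'))
    rw [h5.deriv, hφe, hwe]
    simp only [Real.one_rpow, one_mul, mul_one, div_one, zero_mul, zero_add]
    have e1 : (y ^ m * Q y) ^ (p - 2) = y ^ (m * (p - 2)) * Q y ^ (p - 2) := by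
      rw [Real.mul_rpow (by positivity) hQy.le, ← Real.rpow_mul hy.le]
    have e2 : y ^ (-2:ℝ) * (y ^ (m * (p - 2)) * y ^ m) = 1 := by
      rw [← Real.rpow_add hy, ← Real.rpow_add hy]
      rw [show -2 + (m * (p - 2) + m) = 0 by linarith]; simp
    rw [e1, show p - 1 - 1 = p - 2 by ring, hGe]
    calc _ = (p - 1) * (1 * (Q y ^ (p - 2) * (m * Q y + y * deriv Q y))) := by ring
      _ = _ := by rw [← e2]; ring
  refine ⟨fun k => p * B * pc (-2) k, fun k => -(gam d p) * pc (-1) k, ?_, ?_, ?_, ?_, ?_, ?_⟩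
  · intro k
    have hg0 : 0 < gam d p := by rw [hgam]; linarith
    exact ⟨mul_ne_zero (by positivity) (pc_ne k _ (by norm_num)),
      mul_ne_zero (by linarith) (pc_ne k _ (by norm_num))⟩
  · simp [pc]
  · intro k
    constructor
    · apply near_zero
      refine contDiffAt_const.mul (hQ.smooth.contDiffAt.rpow_const_of_ne ?_)
      rw [hQ.at0]; exact one_ne_zero
    · apply near_zero
      exact contDiffAt_deriv' (hGs.contDiffAt.log (hpos 0 le_rfl).ne')
  · intro k
    have := expansion k _ _ _ _ _ hVe (((sym_rpow k 2).mul (sys0 k).2.2.1).const_mul (-1))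
    refine this.congr (fun y => ?_) (fun y => rfl)
    rw [show -(2 + (k:ℝ)) = -2 - k by ring]
  · intro g hg hg2 k
    have := expansion k _ _ _ _ _ hWe ((sym_rpow k 1).mul (sys g hg hg2 k).2.1)
    refine this.congr (fun y => ?_) (fun y => rfl)
    rw [show -(1 + (k:ℝ)) = -1 - k by ring]
  · intro k
    rw [← hm]
    have := expansion k _ _ _ _ _ hDe (((sym_rpow k 2).mul
      (((sys0 k).2.2.2 (p - 2)).mul (sys0 k).1)).const_mul (p - 1))
    refine this.congr (fun y => ?_) (fun y => ?_)
    · ring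
    · rw [zero_add]

end WaveBlowup
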